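/- Let g_1,…,g_m be real polynomials, K := {x ∈ ℝ^n : g_1(x) ≥ 0,…,g_m(x) ≥ 0}, and f a real polynomial with f_min := inf_{x ∈ K} f(x) finite. Assume the Archimedean condition: there exist N > 0 and sum-of-squares polynomials σ_0, σ_1, …, σ_m such that N − ‖x‖₂² = σ_0 + Σ_{j=1}^m σ_j g_j. For each d, let f_d^{sos} denote the supremum of all λ ∈ ℝ for which there exist sum-of-squares polynomials τ_0 of degree ≤ 2d and τ_j of degree ≤ 2(d − ⌈deg(g_j)/2⌉) with f − λ = τ_0 + Σ_{j=1}^m τ_j g_j. Then the sequence (f_d^{sos})_d is nondecreasing in d, satisfies f_d^{sos} ≤ f_min for every d, and converges to f_min as d → ∞. -/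

import Mathlib

open MvPolynomial Filter

/-- A polynomial is a sum of squares (SOS) if it is a finite sum of squares of
polynomials. -/
def IsSOS {n : ℕ} (σ : MvPolynomial (Fin n) ℝ) : Prop :=
  ∃ (k : ℕ) (p : Fin k → MvPolynomial (Fin n) ℝ), σ = ∑ i, p i ^ 2

/-- The feasible set of the SOS relaxation of order `d`: the set of `λ ∈ ℝ` admitting a
Putinar-type representation `f − λ = τ_0 + Σ_j τ_j g_j` with `τ_0` SOS of degree `≤ 2d`
and each `τ_j` SOS of degree `≤ 2(d − ⌈deg(g_j)/2⌉)`.  Its supremum (in the extended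
reals, so that it is `−∞` when the set is empty) is the bound `f_d^{sos}`. -/
def sosFeas {n m : ℕ} (g : Fin m → MvPolynomial (Fin n) ℝ)
    (f : MvPolynomial (Fin n) ℝ) (d : ℕ) : Set ℝ :=
  {lam : ℝ | ∃ (τ0 : MvPolynomial (Fin n) ℝ) (τ : Fin m → MvPolynomial (Fin n) ℝ),
    IsSOS τ0 ∧ (∀ j, IsSOS (τ j)) ∧
    τ0.totalDegree ≤ 2 * d ∧
    (∀ j, (τ j).totalDegree ≤ 2 * (d - ((g j).totalDegree + 1) / 2)) ∧
    f - MvPolynomial.C lam = τ0 + ∑ j, τ j * g j}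

/-- A subset of a commutative real algebra is a quadratic module if it contains `1` and is closed
under addition and under multiplication by squares. -/
structure IsQuadraticModule {A : Type*} [CommRing A] [Algebra ℝ A] (M : Set A) : Prop where
  one_mem : (1 : A) ∈ M
  add_mem : ∀ {a b : A}, a ∈ M → b ∈ M → a + b ∈ M
  sq_mul_mem : ∀ (a : A) {b : A}, b ∈ M → a ^ 2 * b ∈ M

namespace IsQuadraticModule

variable {A : Type*} [CommRing A] [Algebra ℝ A] {M : Set A}

local notation "κ" => algebraMap ℝ A

lemma sq_mem (hM : IsQuadraticModule M) (a : A) : a ^ 2 ∈ M := by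
  simpa using hM.sq_mul_mem a hM.one_mem

lemma zero_mem (hM : IsQuadraticModule M) : (0 : A) ∈ M := by
  simpa using hM.sq_mem 0

lemma isSumSq_mul_mem (hM : IsQuadraticModule M) {s b : A} (hs : IsSumSq s) (hb : b ∈ M) :
    s * b ∈ M := by
  induction hs with
  | zero => simpa using hM.zero_mem
  | sq_add a _ ih =>
    rw [add_mul, ← pow_two]
    exact hM.add_mem (hM.sq_mul_mem a hb) ih

lemma isSumSq_mem (hM : IsQuadraticModule M) {s : A} (hs : IsSumSq s) : s ∈ M := by
  simpa using hM.isSumSq_mul_mem hs hM.one_mem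

lemma const_mul_mem (hM : IsQuadraticModule M) {c : ℝ} (hc : 0 ≤ c) {b : A} (hb : b ∈ M) :
    κ c * b ∈ M := by
  have := hM.sq_mul_mem (κ (Real.sqrt c)) hb
  rwa [← map_pow, Real.sq_sqrt hc] at this

lemma const_mem (hM : IsQuadraticModule M) {c : ℝ} (hc : 0 ≤ c) : κ c ∈ M := by
  simpa using hM.const_mul_mem hc hM.one_mem

lemma of_const_mul_mem (hM : IsQuadraticModule M) {c : ℝ} (hc : 0 < c) {b : A}
    (hb : κ c * b ∈ M) : b ∈ M := by
  have := hM.const_mul_mem (inv_nonneg.2 hc.le) hb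
  rwa [← mul_assoc, ← map_mul, inv_mul_cancel₀ hc.ne', map_one, one_mul] at this

lemma const_sq_sub_sq_mem (hM : IsQuadraticModule M) {c : ℝ} (hc : 0 < c) {a : A}
    (h₁ : κ c + a ∈ M) (h₂ : κ c - a ∈ M) : κ c ^ 2 - a ^ 2 ∈ M := by
  refine hM.of_const_mul_mem (c := 2 * c) (by positivity) ?_
  have := hM.add_mem (hM.sq_mul_mem (κ c - a) h₁) (hM.sq_mul_mem (κ c + a) h₂)
  convert this using 1
  rw [map_mul, map_ofNat]
  ring

/-- The elements bounded with respect to a quadratic module form a subalgebra. -/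
def boundedSubalgebra (hM : IsQuadraticModule M) : Subalgebra ℝ A where
  carrier := {a | ∃ c : ℝ, 0 < c ∧ κ c + a ∈ M ∧ κ c - a ∈ M}
  algebraMap_mem' r := by
    refine ⟨|r| + 1, by positivity, ?_, ?_⟩
    · rw [← map_add]
      exact hM.const_mem (by linarith [neg_abs_le r])
    · rw [← map_sub]
      exact hM.const_mem (by linarith [le_abs_self r])
  add_mem' := by
    rintro a b ⟨c, hc, h₁, h₂⟩ ⟨d, hd, h₃, h₄⟩
    refine ⟨c + d, by positivity, ?_, ?_⟩
    · convert hM.add_mem h₁ h₃ using 1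
      rw [map_add]; ring
    · convert hM.add_mem h₂ h₄ using 1
      rw [map_add]; ring
  mul_mem' := by
    rintro a b ⟨c, hc, h₁, h₂⟩ ⟨d, hd, h₃, h₄⟩
    have hp : κ (c + d) ^ 2 - (a + b) ^ 2 ∈ M := by
      refine hM.const_sq_sub_sq_mem (by positivity) ?_ ?_
      · convert hM.add_mem h₁ h₃ using 1
        rw [map_add]; ring
      · convert hM.add_mem h₂ h₄ using 1
        rw [map_add]; ring
    have hm : κ (c + d) ^ 2 - (a - b) ^ 2 ∈ M := by
      refine hM.const_sq_sub_sq_mem (by positivity) ?_ ?_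
      · convert hM.add_mem h₁ h₄ using 1
        rw [map_add]; ring
      · convert hM.add_mem h₂ h₃ using 1
        rw [map_add]; ring
    refine ⟨(c + d) ^ 2, by positivity, ?_, ?_⟩ <;>
      refine hM.of_const_mul_mem (c := 4) (by norm_num) ?_
    · convert hM.add_mem (hM.add_mem (hM.sq_mem (a + b)) hm)
        (hM.const_mul_mem (c := 3) (by norm_num) (hM.sq_mem (κ (c + d)))) using 1
      simp only [map_pow, map_ofNat]; ring
    · convert hM.add_mem (hM.add_mem (hM.sq_mem (a - b)) hp)
        (hM.const_mul_mem (c := 3) (by norm_num) (hM.sq_mem (κ (c + d)))) using 1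
      simp only [map_pow, map_ofNat]; ring

lemma mem_boundedSubalgebra (hM : IsQuadraticModule M) {a : A} :
    a ∈ hM.boundedSubalgebra ↔ ∃ c : ℝ, 0 < c ∧ κ c + a ∈ M ∧ κ c - a ∈ M :=
  Iff.rfl

lemma mem_boundedSubalgebra_of_sub_sq_mem (hM : IsQuadraticModule M) {a : A} {c : ℝ}
    (hc : 0 < c) (h : κ c - a ^ 2 ∈ M) : a ∈ hM.boundedSubalgebra := by
  refine hM.mem_boundedSubalgebra.2 ⟨c + 1, by positivity, ?_, ?_⟩ <;>
    refine hM.of_const_mul_mem (c := 2) (by norm_num) ?_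
  · convert hM.add_mem (hM.add_mem h (hM.sq_mem (a + 1))) (hM.const_mem (c := c + 1)
      (by positivity)) using 1
    simp only [map_add, map_one, map_ofNat]; ring
  · convert hM.add_mem (hM.add_mem h (hM.sq_mem (a - 1))) (hM.const_mem (c := c + 1)
      (by positivity)) using 1
    simp only [map_add, map_one, map_ofNat]; ring

/-- A quadratic module is Archimedean if every element of the algebra is bounded by a constant. -/
def IsArchimedean (M : Set A) : Prop :=
  ∀ a : A, ∃ c : ℝ, κ c - a ∈ M

lemma IsArchimedean.mono {M Q : Set A} (h : IsArchimedean M) (hMQ : M ⊆ Q) : IsArchimedean Q :=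
  fun a => (h a).imp fun _ hc => hMQ hc

lemma isArchimedean_of_boundedSubalgebra_eq_top (hM : IsQuadraticModule M)
    (h : hM.boundedSubalgebra = ⊤) : IsArchimedean M := fun a => by
  obtain ⟨c, -, -, hc⟩ := hM.mem_boundedSubalgebra.1 (h ▸ Algebra.mem_top : a ∈ _)
  exact ⟨c, hc⟩

lemma IsArchimedean.exists_forall_ge (hM : IsQuadraticModule M) (hA : IsArchimedean M) (a : A) :
    ∃ c : ℝ, ∀ d, c ≤ d → κ d - a ∈ M := by
  obtain ⟨c, hc⟩ := hA a
  refine ⟨c, fun d hd => ?_⟩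
  convert hM.add_mem hc (hM.const_mem (sub_nonneg.2 hd)) using 1
  rw [map_sub]; ring

/-- If `s * f - 1` lies in an Archimedean quadratic module for a sum of squares `s`, then so
does `f`. -/
lemma mem_of_isSumSq_mul_sub_one_mem (hM : IsQuadraticModule M) (hA : IsArchimedean M) {f s : A}
    (hs : IsSumSq s) (h : s * f - 1 ∈ M) : f ∈ M := by
  obtain ⟨c₁, h₁⟩ := hA.exists_forall_ge hM s
  obtain ⟨c₂, h₂⟩ := hA.exists_forall_ge hM (s ^ 2 * f + 1)
  obtain ⟨k, hk0, hk₁, hk₂⟩ : ∃ k : ℝ, 0 < k ∧ c₁ ≤ 2 * k ∧ c₂ ≤ 2 * k :=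
    ⟨|c₁| + |c₂| + 1, by positivity, by
      linarith [le_abs_self c₁, abs_nonneg c₁, abs_nonneg c₂], by
      linarith [le_abs_self c₂, abs_nonneg c₁, abs_nonneg c₂]⟩
  replace h₁ := h₁ _ hk₁
  replace h₂ := h₂ _ hk₂
  have hs' : s * (κ (2 * k) - s) ∈ M := by
    refine hM.of_const_mul_mem (c := 2 * k) (by positivity) ?_
    convert hM.add_mem (hM.isSumSq_mul_mem hs (hM.sq_mem (κ (2 * k) - s)))
      (hM.sq_mul_mem s h₁) using 1
    ring
  have step : ∀ r : ℝ, 0 ≤ r → f + κ r ∈ M → f + κ (r - 1 / k ^ 2) ∈ M := by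
    intro r hr hf
    refine hM.of_const_mul_mem (c := k ^ 2) (by positivity) ?_
    convert hM.add_mem (hM.add_mem (hM.sq_mul_mem (κ k - s) hf)
      (hM.const_mul_mem (c := 2 * k) (by positivity) h))
      (hM.add_mem (hM.const_mul_mem hr hs') h₂) using 1
    have e : κ (k ^ 2) * κ (r - 1 / k ^ 2) = κ k ^ 2 * κ r - 1 := by
      rw [← map_mul, ← map_pow, ← map_mul, ← map_one κ, ← map_sub]
      congr 1
      field_simp
    rw [mul_add, e]
    simp only [map_mul, map_pow, map_ofNat]
    ring
  obtain ⟨c, hc⟩ := hA.exists_forall_ge hM (-f)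
  have key : ∀ i : ℕ, f + κ (max 0 (|c| - i / k ^ 2)) ∈ M := by
    intro i
    induction i with
    | zero =>
      have := hc (max 0 (|c| - (0 : ℕ) / k ^ 2)) (by simp [le_abs_self])
      rwa [sub_neg_eq_add, add_comm] at this
    | succ i ih =>
      have h3 := step _ (le_max_left _ _) ih
      set r := max 0 (|c| - i / k ^ 2)
      have hle : r - 1 / k ^ 2 ≤ max 0 (|c| - (i + 1 : ℕ) / k ^ 2) := by
        have hk : 0 < 1 / k ^ 2 := by positivity
        rcases max_cases (0 : ℝ) (|c| - i / k ^ 2) with h | h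
        · exact le_max_of_le_left (by simp only [r, h.1]; linarith)
        · refine le_max_of_le_right (le_of_eq ?_)
          simp only [r, h.1]
          push_cast
          ring
      convert hM.add_mem h3 (hM.const_mem (sub_nonneg.2 hle)) using 1
      rw [add_assoc, ← map_add]
      congr 2
      ring
  obtain ⟨i, hi⟩ := exists_nat_ge (|c| * k ^ 2)
  have := key i
  rwa [max_eq_left, map_zero, add_zero] at this
  rw [sub_nonpos, le_div_iff₀ (by positivity)]
  exact hi

lemma sub_isSumSq_mul (hM : IsQuadraticModule M) (f : A) :
    IsQuadraticModule {a : A | ∃ q ∈ M, ∃ s, IsSumSq s ∧ a = q - s * f} where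
  one_mem := ⟨1, hM.one_mem, 0, .zero, by simp⟩
  add_mem := by
    rintro _ _ ⟨q, hq, s, hs, rfl⟩ ⟨q', hq', s', hs', rfl⟩
    exact ⟨q + q', hM.add_mem hq hq', s + s', hs.add hs', by ring⟩
  sq_mul_mem := by
    rintro a _ ⟨q, hq, s, hs, rfl⟩
    refine ⟨a ^ 2 * q, hM.sq_mul_mem a hq, a ^ 2 * s, ?_, by ring⟩
    exact (IsSquare.sq a).isSumSq.mul hs

lemma exists_maximal (hM : IsQuadraticModule M) (h : -1 ∉ M) :
    ∃ Q, M ⊆ Q ∧ Maximal (fun Q : Set A => IsQuadraticModule Q ∧ -1 ∉ Q) Q := by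
  refine zorn_subset_nonempty {Q : Set A | IsQuadraticModule Q ∧ -1 ∉ Q} ?_ M ⟨hM, h⟩
  rintro c hc hchain ⟨Q₀, hQ₀⟩
  refine ⟨⋃₀ c, ⟨⟨?_, ?_, ?_⟩, ?_⟩, fun Q hQ => Set.subset_sUnion_of_mem hQ⟩
  · exact ⟨Q₀, hQ₀, (hc hQ₀).1.one_mem⟩
  · rintro a b ⟨Q, hQ, ha⟩ ⟨Q', hQ', hb⟩
    rcases hchain.total hQ hQ' with h | h
    · exact ⟨Q', hQ', (hc hQ').1.add_mem (h ha) hb⟩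
    · exact ⟨Q, hQ, (hc hQ).1.add_mem ha (h hb)⟩
  · rintro a b ⟨Q, hQ, hb⟩
    exact ⟨Q, hQ, (hc hQ).1.sq_mul_mem a hb⟩
  · rintro ⟨Q, hQ, h⟩
    exact (hc hQ).2 h

lemma neg_mem_of_maximal {Q : Set A}
    (hQ : Maximal (fun Q : Set A => IsQuadraticModule Q ∧ -1 ∉ Q) Q)
    (hA : IsArchimedean Q) {a : A} (ha : a ∉ Q) : -a ∈ Q := by
  have hQm := hQ.prop.1
  refine hQ.le_of_ge (y := {b : A | ∃ q ∈ Q, ∃ s, IsSumSq s ∧ b = q - s * a})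
    ⟨hQm.sub_isSumSq_mul a, ?_⟩ (fun q hq => ⟨q, hq, 0, .zero, by simp⟩)
    ⟨0, hQm.zero_mem, 1, IsSquare.one.isSumSq, by simp⟩
  rintro ⟨q, hq, s, hs, h⟩
  refine ha (hQm.mem_of_isSumSq_mul_sub_one_mem hA hs ?_)
  convert hq using 1
  linear_combination h

/-- A total proper Archimedean quadratic module is nonnegative under some character. -/
lemma exists_algHom_nonneg {Q : Set A} (hQ : IsQuadraticModule Q) (hQ1 : -1 ∉ Q)
    (hA : IsArchimedean Q) (htot : ∀ a, a ∉ Q → -a ∈ Q) :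
    ∃ φ : A →ₐ[ℝ] ℝ, ∀ a ∈ Q, 0 ≤ φ a := by
  have hneg : ∀ r : ℝ, κ r ∈ Q → 0 ≤ r := by
    intro r hr
    by_contra! h
    refine hQ1 (hQ.of_const_mul_mem (c := -r) (by linarith) ?_)
    rwa [map_neg, neg_mul_neg, mul_one]
  have hex : ∀ a : A, ∃ t : ℝ, ∀ ε > 0, κ ε + (a - κ t) ∈ Q ∧ κ ε - (a - κ t) ∈ Q := by
    intro a
    obtain ⟨c, hc⟩ := hA a
    obtain ⟨d, hd⟩ := hA (-a)
    set S := {r : ℝ | a - κ r ∈ Q}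
    have hS : S.Nonempty := ⟨-d, by
      change a - κ (-d) ∈ Q
      convert hd using 1
      rw [map_neg]; ring⟩
    have hSb : BddAbove S := ⟨c, fun r hr => by
      have := hneg (c - r) (by
        convert hQ.add_mem hc hr using 1
        rw [map_sub]; ring)
      linarith⟩
    refine ⟨sSup S, fun ε hε => ⟨?_, ?_⟩⟩
    · obtain ⟨r, hr, hlt⟩ := exists_lt_of_lt_csSup hS (sub_lt_self (sSup S) hε)
      convert hQ.add_mem hr (hQ.const_mem (c := ε - sSup S + r) (by linarith)) using 1
      simp only [map_add, map_sub]; ring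
    · have : sSup S + ε ∉ S := fun h => by linarith [le_csSup hSb h]
      convert htot _ this using 1
      rw [map_add]; ring
  choose φ hφ using hex
  have huniq : ∀ a t, (∀ ε > 0, κ ε + (a - κ t) ∈ Q ∧ κ ε - (a - κ t) ∈ Q) → φ a = t := by
    intro a t h
    refine le_antisymm (le_of_forall_pos_le_add fun ε hε => ?_)
      (le_of_forall_pos_le_add fun ε hε => ?_)
    · have := hneg (t + ε - φ a) (by
        convert hQ.add_mem (h (ε / 2) (half_pos hε)).2 (hφ a (ε / 2) (half_pos hε)).1 using 1
        rw [show t + ε - φ a = t + (ε / 2 + ε / 2) - φ a by ring]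
        simp only [map_add, map_sub]; ring)
      linarith
    · have := hneg (φ a + ε - t) (by
        convert hQ.add_mem (h (ε / 2) (half_pos hε)).1 (hφ a (ε / 2) (half_pos hε)).2 using 1
        rw [show φ a + ε - t = φ a + (ε / 2 + ε / 2) - t by ring]
        simp only [map_add, map_sub]; ring)
      linarith
  have hconst : ∀ r : ℝ, φ (κ r) = r := fun r => huniq _ _ fun ε hε => by
    simp [hQ.const_mem hε.le]
  have hadd : ∀ a b, φ (a + b) = φ a + φ b := fun a b => huniq _ _ fun ε hε => by
    have ha := hφ a (ε / 2) (half_pos hε)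
    have hb := hφ b (ε / 2) (half_pos hε)
    have e : κ ε = κ (ε / 2) + κ (ε / 2) := by rw [← map_add, add_halves]
    constructor
    · convert hQ.add_mem ha.1 hb.1 using 1
      rw [e, map_add]; ring
    · convert hQ.add_mem ha.2 hb.2 using 1
      rw [e, map_add]; ring
  have hsmul : ∀ (c : ℝ) (a : A), 0 < c → φ (κ c * a) = c * φ a := fun c a hc =>
    huniq _ _ fun ε hε => by
      have ha := hφ a (ε / c) (by positivity)
      have e : κ ε = κ c * κ (ε / c) := by rw [← map_mul, mul_div_cancel₀ _ hc.ne']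
      constructor
      · convert hQ.const_mul_mem hc.le ha.1 using 1
        rw [e, map_mul]; ring
      · convert hQ.const_mul_mem hc.le ha.2 using 1
        rw [e, map_mul]; ring
  have hnegφ : ∀ a, φ (-a) = -φ a := fun a => by
    have h1 := hadd a (-a)
    have h2 := hconst 0
    rw [map_zero] at h2
    rw [add_neg_cancel, h2] at h1
    linarith
  have hsmul' : ∀ (c : ℝ) (a : A), φ (κ c * a) = c * φ a := by
    intro c a
    rcases lt_trichotomy c 0 with hc | rfl | hc
    · have := hsmul (-c) a (by linarith)
      rw [map_neg, neg_mul, hnegφ] at this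
      linarith
    · simpa using hconst 0
    · exact hsmul c a hc
  have hsq0 : ∀ a, φ a = 0 → φ (a ^ 2) = 0 := fun a ha => huniq _ _ fun ε hε => by
    have h := hφ a (Real.sqrt ε) (Real.sqrt_pos.2 hε)
    simp only [ha, map_zero, sub_zero] at h ⊢
    refine ⟨hQ.add_mem (hQ.const_mem hε.le) (hQ.sq_mem a), ?_⟩
    have := hQ.const_sq_sub_sq_mem (Real.sqrt_pos.2 hε) h.1 h.2
    rwa [← map_pow, Real.sq_sqrt hε.le] at this
  have hsq : ∀ a, φ (a ^ 2) = φ a ^ 2 := by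
    intro a
    have h0 : φ (a + κ (-φ a)) = 0 := by rw [hadd, hconst]; ring
    have h1 := hsq0 _ h0
    have e : (a + κ (-φ a)) ^ 2 = a ^ 2 + κ (-2 * φ a) * a + κ (φ a ^ 2) := by
      simp only [map_mul, map_neg, map_pow, map_ofNat]; ring
    rw [e, hadd, hadd, hsmul', hconst] at h1
    linear_combination h1
  have hmul : ∀ a b, φ (a * b) = φ a * φ b := by
    intro a b
    have h1 := hsq (a + b)
    have e : (a + b) ^ 2 = a ^ 2 + κ 2 * (a * b) + b ^ 2 := by
      rw [map_ofNat]; ring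
    rw [e, hadd, hadd, hsmul', hadd, hsq, hsq] at h1
    linear_combination h1 / 2
  refine ⟨{ toFun := φ
            map_one' := by simpa using hconst 1
            map_mul' := hmul
            map_zero' := by simpa using hconst 0
            map_add' := hadd
            commutes' := hconst }, fun a ha => ?_⟩
  change 0 ≤ φ a
  refine le_of_forall_pos_le_add fun ε hε => hneg _ ?_
  convert hQ.add_mem (hφ a ε hε).2 ha using 1
  rw [map_add]; ring

/-- **Representation theorem** for Archimedean quadratic modules: an element that is positive under
every character nonnegative on the module belongs to the module. -/
theorem mem_of_forall_algHom_pos (hM : IsQuadraticModule M) (hA : IsArchimedean M) {f : A}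
    (hf : ∀ φ : A →ₐ[ℝ] ℝ, (∀ a ∈ M, 0 ≤ φ a) → 0 < φ f) : f ∈ M := by
  by_contra hfM
  obtain ⟨Q, hle, hQ⟩ := (hM.sub_isSumSq_mul f).exists_maximal (by
    rintro ⟨q, hq, s, hs, h⟩
    refine hfM (hM.mem_of_isSumSq_mul_sub_one_mem hA hs ?_)
    convert hq using 1
    linear_combination h)
  have hMQ : M ⊆ Q := fun q hq => hle ⟨q, hq, 0, .zero, by simp⟩
  obtain ⟨φ, hφ⟩ := exists_algHom_nonneg hQ.prop.1 hQ.prop.2 (hA.mono hMQ)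
    fun a => neg_mem_of_maximal hQ (hA.mono hMQ)
  have h1 := hφ (-f) (hle ⟨0, hM.zero_mem, 1, IsSquare.one.isSumSq, by simp⟩)
  have h2 := hf φ fun a ha => hφ a (hMQ ha)
  rw [map_neg] at h1
  linarith

end IsQuadraticModule

lemma isSOS_iff_isSumSq {n : ℕ} {σ : MvPolynomial (Fin n) ℝ} : IsSOS σ ↔ IsSumSq σ := by
  constructor
  · rintro ⟨k, p, rfl⟩
    exact IsSumSq.sum fun i _ => (IsSquare.sq (p i)).isSumSq
  · intro h
    induction h with
    | zero => exact ⟨0, Fin.elim0, by simp⟩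
    | sq_add a _ ih =>
      obtain ⟨k, p, rfl⟩ := ih
      exact ⟨k + 1, Fin.cons a p, by simp [Fin.sum_univ_succ, pow_two]⟩

lemma IsSOS.eval_nonneg {n : ℕ} {σ : MvPolynomial (Fin n) ℝ} (h : IsSOS σ) (x : Fin n → ℝ) :
    0 ≤ eval x σ := by
  obtain ⟨k, p, rfl⟩ := h
  simp only [map_sum, map_pow]
  positivity

/-- The quadratic module generated by finitely many polynomials. -/
def quadraticModuleSpan {n m : ℕ} (g : Fin m → MvPolynomial (Fin n) ℝ) :
    Set (MvPolynomial (Fin n) ℝ) :=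
  {p | ∃ (τ0 : MvPolynomial (Fin n) ℝ) (τ : Fin m → MvPolynomial (Fin n) ℝ),
    IsSOS τ0 ∧ (∀ j, IsSOS (τ j)) ∧ p = τ0 + ∑ j, τ j * g j}

lemma isQuadraticModule_span {n m : ℕ} (g : Fin m → MvPolynomial (Fin n) ℝ) :
    IsQuadraticModule (quadraticModuleSpan g) where
  one_mem := ⟨1, 0, isSOS_iff_isSumSq.2 IsSquare.one.isSumSq,
    fun _ => isSOS_iff_isSumSq.2 .zero, by simp⟩
  add_mem := by
    rintro _ _ ⟨τ0, τ, h0, h, rfl⟩ ⟨τ0', τ', h0', h', rfl⟩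
    simp only [isSOS_iff_isSumSq] at *
    refine ⟨τ0 + τ0', τ + τ', isSOS_iff_isSumSq.2 (h0.add h0'),
      fun j => isSOS_iff_isSumSq.2 ((h j).add (h' j)), ?_⟩
    simp only [Pi.add_apply, add_mul, Finset.sum_add_distrib]
    ring
  sq_mul_mem := by
    rintro a _ ⟨τ0, τ, h0, h, rfl⟩
    simp only [isSOS_iff_isSumSq] at *
    refine ⟨a ^ 2 * τ0, fun j => a ^ 2 * τ j,
      isSOS_iff_isSumSq.2 ((IsSquare.sq a).isSumSq.mul h0),
      fun j => isSOS_iff_isSumSq.2 ((IsSquare.sq a).isSumSq.mul (h j)), ?_⟩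
    simp only [mul_add, Finset.mul_sum, mul_assoc]

lemma mem_quadraticModuleSpan {n m : ℕ} (g : Fin m → MvPolynomial (Fin n) ℝ) (j : Fin m) :
    g j ∈ quadraticModuleSpan g := by
  refine ⟨0, Pi.single j 1, isSOS_iff_isSumSq.2 .zero, fun i => isSOS_iff_isSumSq.2 ?_, ?_⟩
  · rcases eq_or_ne i j with rfl | h
    · simp
    · simp [h]
  · simp [Pi.single_apply]

/-- If a quadratic module contains `N - ‖x‖²`, it is Archimedean. -/
lemma IsQuadraticModule.isArchimedean_of_ball {n : ℕ} {M : Set (MvPolynomial (Fin n) ℝ)}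
    (hM : IsQuadraticModule M) {N : ℝ} (hN : 0 < N)
    (h : MvPolynomial.C N - ∑ i, MvPolynomial.X i ^ 2 ∈ M) :
    IsQuadraticModule.IsArchimedean M := by
  refine hM.isArchimedean_of_boundedSubalgebra_eq_top (top_le_iff.1 ?_)
  rw [← MvPolynomial.adjoin_range_X, Algebra.adjoin_le_iff]
  rintro _ ⟨i, rfl⟩
  refine hM.mem_boundedSubalgebra_of_sub_sq_mem hN ?_
  have hsum : ∑ k ∈ Finset.univ.erase i, (X k : MvPolynomial (Fin n) ℝ) ^ 2 ∈ M :=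
    hM.isSumSq_mem (IsSumSq.sum fun k _ => (IsSquare.sq _).isSumSq)
  convert hM.add_mem h hsum using 1
  rw [← Finset.add_sum_erase _ _ (Finset.mem_univ i), MvPolynomial.algebraMap_eq]
  ring

/-- **Putinar's Positivstellensatz.** -/
theorem putinar_positivstellensatz {n m : ℕ} (g : Fin m → MvPolynomial (Fin n) ℝ) {N : ℝ}
    (hN : 0 < N)
    (harch : MvPolynomial.C N - ∑ i, MvPolynomial.X i ^ 2 ∈ quadraticModuleSpan g)
    {f : MvPolynomial (Fin n) ℝ}
    (hf : ∀ x : Fin n → ℝ, (∀ j, 0 ≤ eval x (g j)) → 0 < eval x f) :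
    f ∈ quadraticModuleSpan g := by
  have hM := isQuadraticModule_span g
  refine hM.mem_of_forall_algHom_pos (hM.isArchimedean_of_ball hN harch) fun φ hφ => ?_
  have hev : ∀ p, φ p = eval (fun i => φ (X i)) p := fun p => by
    rw [← MvPolynomial.coe_aeval_eq_eval]
    exact DFunLike.congr_fun (MvPolynomial.aeval_unique φ) p
  rw [hev]
  refine hf _ fun j => ?_
  rw [← hev]
  exact hφ _ (mem_quadraticModuleSpan g j)

lemma sosFeas_mono {n m : ℕ} (g : Fin m → MvPolynomial (Fin n) ℝ)
    (f : MvPolynomial (Fin n) ℝ) : Monotone (sosFeas g f) := by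
  rintro d d' hd lam ⟨τ0, τ, h0, h, hd0, hdj, e⟩
  refine ⟨τ0, τ, h0, h, hd0.trans (by gcongr), fun j => (hdj j).trans (by gcongr), e⟩

lemma le_eval_of_mem_sosFeas {n m : ℕ} {g : Fin m → MvPolynomial (Fin n) ℝ}
    {f : MvPolynomial (Fin n) ℝ} {d : ℕ} {lam : ℝ} (h : lam ∈ sosFeas g f d) {x : Fin n → ℝ}
    (hx : ∀ j, 0 ≤ eval x (g j)) : lam ≤ eval x f := by
  obtain ⟨τ0, τ, h0, h, -, -, e⟩ := h
  have e' := congrArg (eval x) e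
  simp only [map_sub, map_add, map_sum, map_mul, eval_C] at e'
  have h1 := h0.eval_nonneg x
  have h2 : 0 ≤ ∑ j, eval x (τ j) * eval x (g j) :=
    Finset.sum_nonneg fun j _ => mul_nonneg ((h j).eval_nonneg x) (hx j)
  linarith

lemma exists_mem_sosFeas {n m : ℕ} {g : Fin m → MvPolynomial (Fin n) ℝ}
    {f : MvPolynomial (Fin n) ℝ} {lam : ℝ}
    (h : f - MvPolynomial.C lam ∈ quadraticModuleSpan g) : ∃ d, lam ∈ sosFeas g f d := by
  obtain ⟨τ0, τ, h0, h, e⟩ := h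
  refine ⟨τ0.totalDegree + ∑ j, ((τ j).totalDegree + ((g j).totalDegree + 1) / 2),
    τ0, τ, h0, h, by omega, fun j => ?_, e⟩
  have := Finset.single_le_sum
    (f := fun j => (τ j).totalDegree + ((g j).totalDegree + 1) / 2)
    (fun _ _ => Nat.zero_le _) (Finset.mem_univ j)
  omega

/-- **convergence of the SOS hierarchy under the Archimedean condition.**
Let `K := {x : g_j(x) ≥ 0 ∀j}` and `f` a real polynomial with
`f_min := inf_{x ∈ K} f(x)` finite (`K` nonempty and `f` bounded below on `K`).  Assume
the Archimedean condition: there are `N > 0` and SOS polynomials `σ_0,…,σ_m` with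
`N − ‖x‖₂² = σ_0 + Σ_j σ_j g_j`.  Then the sequence `d ↦ f_d^{sos}` of SOS relaxation
bounds is nondecreasing, satisfies `f_d^{sos} ≤ f_min` for every `d`, and converges to
`f_min` as `d → ∞`. -/
theorem stmt_9 {n m : ℕ} (g : Fin m → MvPolynomial (Fin n) ℝ)
    (f : MvPolynomial (Fin n) ℝ)
    (hKne : {x : Fin n → ℝ | ∀ j, 0 ≤ eval x (g j)}.Nonempty)
    (hbdd : BddBelow ((fun x => eval x f) '' {x : Fin n → ℝ | ∀ j, 0 ≤ eval x (g j)}))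
    (N : ℝ) (hN : 0 < N)
    (σ0 : MvPolynomial (Fin n) ℝ) (σ : Fin m → MvPolynomial (Fin n) ℝ)
    (hσ0 : IsSOS σ0) (hσ : ∀ j, IsSOS (σ j))
    (harch : MvPolynomial.C N - ∑ i, MvPolynomial.X i ^ 2 = σ0 + ∑ j, σ j * g j) :
    Monotone (fun d : ℕ => sSup ((fun lam : ℝ => (lam : EReal)) '' sosFeas g f d)) ∧
    (∀ d : ℕ, sSup ((fun lam : ℝ => (lam : EReal)) '' sosFeas g f d) ≤
      ((sInf ((fun x => eval x f) ''
        {x : Fin n → ℝ | ∀ j, 0 ≤ eval x (g j)}) : ℝ) : EReal)) ∧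
    Tendsto (fun d : ℕ => sSup ((fun lam : ℝ => (lam : EReal)) '' sosFeas g f d))
      atTop (nhds ((sInf ((fun x => eval x f) ''
        {x : Fin n → ℝ | ∀ j, 0 ≤ eval x (g j)}) : ℝ) : EReal)) := by
  have hmono : Monotone (fun d : ℕ => sSup ((fun lam : ℝ => (lam : EReal)) '' sosFeas g f d)) :=
    fun d d' hd => sSup_le_sSup (Set.image_mono (sosFeas_mono g f hd))
  have hle : ∀ d : ℕ, sSup ((fun lam : ℝ => (lam : EReal)) '' sosFeas g f d) ≤
      ((sInf ((fun x => eval x f) ''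
        {x : Fin n → ℝ | ∀ j, 0 ≤ eval x (g j)}) : ℝ) : EReal) := by
    refine fun d => sSup_le ?_
    rintro _ ⟨lam, hlam, rfl⟩
    refine EReal.coe_le_coe_iff.2 (le_csInf (hKne.image _) ?_)
    rintro _ ⟨x, hx, rfl⟩
    exact le_eval_of_mem_sosFeas hlam hx
  refine ⟨hmono, hle, tendsto_atTop_isLUB hmono ⟨?_, fun b hb => ?_⟩⟩
  · rintro _ ⟨d, rfl⟩
    exact hle d
  · refine le_of_forall_lt fun c hc => ?_
    obtain ⟨lam, hc, hlam⟩ := EReal.lt_iff_exists_real_btwn.1 hc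
    rw [EReal.coe_lt_coe_iff] at hlam
    obtain ⟨d, hd⟩ : ∃ d, lam ∈ sosFeas g f d := by
      refine exists_mem_sosFeas
        (putinar_positivstellensatz g hN ⟨σ0, σ, hσ0, hσ, harch⟩ fun x hx => ?_)
      have := csInf_le hbdd ⟨x, hx, rfl⟩
      simp only [map_sub, eval_C]
      linarith
    exact hc.trans_le ((le_sSup (Set.mem_image_of_mem _ hd)).trans (hb (Set.mem_range_self d)))
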